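/- arXiv:1011.3401 — 3 statements merged into one kernel-verified Lean document; each statement's English description precedes it below -/
import Mathlib

section
/- Let U be an open subset of ℝⁿ, let ω be a smooth closed 2-form on U, and let X and E be smooth vector fields on U such that d(ι_X ω) = 0, L_E ω = k • ω, and the Lie bracket satisfies [E, X] = l • X, where k, l are real numbers with k + l ≠ 0. Then ι_X ω = dH, where H is the smooth function H(x) = (1/(k+l)) · ω_x(X(x), E(x)). In particular, if ω is in addition nondegenerate, then X is the Hamiltonian vector field of H. -/
open scoped BigOperators

/-- The exterior derivative of a (raw) `p`-form on `ℝⁿ`, defined from the Fréchet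
derivative by the usual antisymmetrization formula. -/
noncomputable def extD {n p : ℕ}
    (ω : (Fin n → ℝ) → (Fin p → (Fin n → ℝ)) → ℝ) :
    (Fin n → ℝ) → (Fin (p + 1) → (Fin n → ℝ)) → ℝ :=
  fun x v => ∑ i : Fin (p + 1),
    (-1 : ℝ) ^ (i : ℕ) *
      fderiv ℝ (fun y => ω y (fun j => v (i.succAbove j))) x (v i)

/-- The interior product (contraction) of a raw `(p+1)`-form with a vector field. -/
def interiorProd {n p : ℕ} (X : (Fin n → ℝ) → (Fin n → ℝ))
    (ω : (Fin n → ℝ) → (Fin (p + 1) → (Fin n → ℝ)) → ℝ) :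
    (Fin n → ℝ) → (Fin p → (Fin n → ℝ)) → ℝ :=
  fun x v => ω x (Fin.cons (X x) v)

/-- The Lie derivative, via Cartan's magic formula `L_X = d ∘ ι_X + ι_X ∘ d`. -/
noncomputable def lieDeriv {n p : ℕ} (X : (Fin n → ℝ) → (Fin n → ℝ))
    (ω : (Fin n → ℝ) → (Fin (p + 1) → (Fin n → ℝ)) → ℝ) :
    (Fin n → ℝ) → (Fin (p + 1) → (Fin n → ℝ)) → ℝ :=
  fun x v => extD (interiorProd X ω) x v + interiorProd X (extD ω) x v

lemma two_form_expand {n : ℕ} (B : (Fin n → ℝ) [⋀^Fin 2]→ₗ[ℝ] ℝ) (u v : Fin n → ℝ) :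
    B ![u, v] = ∑ i, ∑ j, u i * v j * B ![Pi.single i 1, Pi.single j 1] := by
  have h1 : ∀ u v, B ![u, v] = ∑ i, u i * B ![Pi.single i 1, v] := by
    intro u v
    let L : (Fin n → ℝ) →ₗ[ℝ] ℝ := B.toMultilinearMap.toLinearMap ![0, v] 0
    have hL : ∀ u, L u = B ![u, v] := by
      intro u
      change B (Function.update ![0, v] 0 u) = _
      congr 1
      ext i
      fin_cases i <;> rfl
    simp only [← hL]
    rw [LinearMap.pi_apply_eq_sum_univ L u]
    refine Finset.sum_congr rfl fun i _ => ?_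
    rw [smul_eq_mul]
    congr 2
    ext j
    simp [Pi.single_apply, eq_comm]
  have h2 : ∀ u v, B ![u, v] = - B ![v, u] := by
    intro u v
    have := B.map_swap ![v, u] (i := 0) (j := 1) (by decide)
    rw [← this]
    congr 1
    ext i
    fin_cases i <;> simp
  rw [h1]
  refine Finset.sum_congr rfl fun i _ => ?_
  rw [h2, h1, ← Finset.sum_neg_distrib, Finset.mul_sum]
  refine Finset.sum_congr rfl fun j _ => ?_
  rw [h2]
  ring

lemma two_form_swap {n : ℕ} (B : (Fin n → ℝ) [⋀^Fin 2]→ₗ[ℝ] ℝ) (u v : Fin n → ℝ) :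
    B ![u, v] = - B ![v, u] := by
  have := B.map_swap ![v, u] (i := 0) (j := 1) (by decide)
  rw [← this]
  congr 1
  ext i
  fin_cases i <;> simp

lemma two_form_fderiv {n : ℕ} (ω : (Fin n → ℝ) → ((Fin n → ℝ) [⋀^Fin 2]→ₗ[ℝ] ℝ))
    (x : Fin n → ℝ) (hω : ∀ v, DifferentiableAt ℝ (fun y => ω y v) x)
    (P Q : (Fin n → ℝ) → (Fin n → ℝ)) (hP : DifferentiableAt ℝ P x)
    (hQ : DifferentiableAt ℝ Q x) (w : Fin n → ℝ) :
    fderiv ℝ (fun y => ω y ![P y, Q y]) x w =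
      fderiv ℝ (fun y => ω y ![P x, Q x]) x w + ω x ![fderiv ℝ P x w, Q x]
        + ω x ![P x, fderiv ℝ Q x w] := by
  have key : ∀ P Q : (Fin n → ℝ) → (Fin n → ℝ), DifferentiableAt ℝ P x →
      DifferentiableAt ℝ Q x → fderiv ℝ (fun y => ω y ![P y, Q y]) x w =
      ∑ i, ∑ j, (P x i * Q x j * fderiv ℝ (fun y => ω y ![Pi.single i 1, Pi.single j 1]) x w
        + fderiv ℝ P x w i * Q x j * ω x ![Pi.single i 1, Pi.single j 1]
        + P x i * fderiv ℝ Q x w j * ω x ![Pi.single i 1, Pi.single j 1]) := by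
    intro P Q hP hQ
    have hPi := hasFDerivAt_pi'.1 hP.hasFDerivAt
    have hQi := hasFDerivAt_pi'.1 hQ.hasFDerivAt
    have hs : HasFDerivAt (fun y => ∑ i, ∑ j,
        P y i * Q y j * ω y ![Pi.single i 1, Pi.single j 1]) _ x :=
      HasFDerivAt.fun_sum fun i _ => HasFDerivAt.fun_sum fun j _ =>
        ((hPi i).fun_mul (hQi j)).fun_mul (hω ![Pi.single i 1, Pi.single j 1]).hasFDerivAt
    simp only [two_form_expand (ω _) (P _) (Q _)]
    rw [hs.fderiv]
    simp only [sum_apply]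
    refine Finset.sum_congr rfl fun i _ => Finset.sum_congr rfl fun j _ => ?_
    simp
    ring
  rw [key P Q hP hQ, key (fun _ => P x) (fun _ => Q x) (by fun_prop) (by fun_prop),
    two_form_expand _ (fderiv ℝ P x w), two_form_expand _ (P x) (fderiv ℝ Q x w)]
  simp [Finset.sum_add_distrib]

/-- A symplectic (here: closed) vector field `X` for a closed 2-form `ω` on an open
`U ⊆ ℝⁿ` with `L_E ω = k • ω` and `[E, X] = l • X`, `k + l ≠ 0`, satisfies
`ι_X ω = dH` with `H = (1/(k+l)) ω(X, E)`; in particular, if `ω` is nondegenerate,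
`X` is the Hamiltonian vector field of `H`. -/
theorem symplectic_vector_field_is_hamiltonian
    {n : ℕ} {U : Set (Fin n → ℝ)} (hU : IsOpen U)
    (ω : (Fin n → ℝ) → ((Fin n → ℝ) [⋀^Fin 2]→ₗ[ℝ] ℝ))
    (X E : (Fin n → ℝ) → (Fin n → ℝ))
    (hω : ∀ v : Fin 2 → (Fin n → ℝ), ContDiffOn ℝ (⊤ : ℕ∞) (fun x => ω x v) U)
    (hX : ContDiffOn ℝ (⊤ : ℕ∞) X U) (hE : ContDiffOn ℝ (⊤ : ℕ∞) E U)
    (k l : ℝ) (hkl : k + l ≠ 0)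
    (hclosed : ∀ x ∈ U, ∀ v : Fin 3 → (Fin n → ℝ),
      extD (fun y w => ω y w) x v = 0)
    (hXsymp : ∀ x ∈ U, ∀ v : Fin 2 → (Fin n → ℝ),
      extD (interiorProd X fun y w => ω y w) x v = 0)
    (hLie : ∀ x ∈ U, ∀ v : Fin 2 → (Fin n → ℝ),
      lieDeriv E (fun y w => ω y w) x v = k * ω x v)
    (hbracket : ∀ x ∈ U, fderiv ℝ X x (E x) - fderiv ℝ E x (X x) = l • X x) :
    ∀ x ∈ U, ∀ v : Fin 1 → (Fin n → ℝ),
      interiorProd X (fun y w => ω y w) x v =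
        extD (fun y (_ : Fin 0 → (Fin n → ℝ)) => (1 / (k + l)) * ω y ![X y, E y]) x v := by
  intro x hx v
  have hxU := hU.mem_nhds hx
  have dω : ∀ v, DifferentiableAt ℝ (fun y => ω y v) x := fun v =>
    ((hω v).contDiffAt hxU).differentiableAt (by simp)
  have dX : DifferentiableAt ℝ X x := (hX.contDiffAt hxU).differentiableAt (by simp)
  have dE : DifferentiableAt ℝ E x := (hE.contDiffAt hxU).differentiableAt (by simp)
  -- exterior derivative of a contraction
  have hd : ∀ Z : (Fin n → ℝ) → (Fin n → ℝ), DifferentiableAt ℝ Z x → ∀ a b,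
      extD (interiorProd Z fun y w => ω y w) x ![a, b] =
        (fderiv ℝ (fun y => ω y ![Z x, b]) x a + ω x ![fderiv ℝ Z x a, b])
        - (fderiv ℝ (fun y => ω y ![Z x, a]) x b + ω x ![fderiv ℝ Z x b, a]) := by
    intro Z hZ a b
    have e : ∀ c d, fderiv ℝ (fun y => ω y ![Z y, d]) x c =
        fderiv ℝ (fun y => ω y ![Z x, d]) x c + ω x ![fderiv ℝ Z x c, d] := by
      intro c d
      have := two_form_fderiv ω x dω Z (fun _ => d) hZ (by fun_prop) c
      have h0 : ω x ![Z x, 0] = 0 := (ω x).map_coord_zero 1 (by simp)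
      simpa [h0] using this
    rw [← e, ← e]
    have f0 : ∀ y, (Fin.cons (Z y) (fun j : Fin 1 => (![a, b] : Fin 2 → Fin n → ℝ)
        ((0 : Fin 2).succAbove j)) : Fin 2 → Fin n → ℝ) = ![Z y, b] := by
      intro y; ext i; fin_cases i <;> rfl
    have f1 : ∀ y, (Fin.cons (Z y) (fun j : Fin 1 => (![a, b] : Fin 2 → Fin n → ℝ)
        ((1 : Fin 2).succAbove j)) : Fin 2 → Fin n → ℝ) = ![Z y, a] := by
      intro y; ext i; fin_cases i <;> rfl
    refine (Fin.sum_univ_two _).trans ?_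
    change (-1 : ℝ) ^ 0 * fderiv ℝ (fun y => ω y (Fin.cons (Z y) (fun j : Fin 1 =>
        (![a, b] : Fin 2 → Fin n → ℝ) ((0 : Fin 2).succAbove j)))) x a
      + (-1 : ℝ) ^ 1 * fderiv ℝ (fun y => ω y (Fin.cons (Z y) (fun j : Fin 1 =>
        (![a, b] : Fin 2 → Fin n → ℝ) ((1 : Fin 2).succAbove j)))) x b = _
    simp only [f0, f1]
    ring
  have hcl : ∀ a b c, extD (fun y w => ω y w) x ![a, b, c] =
      fderiv ℝ (fun y => ω y ![b, c]) x a - fderiv ℝ (fun y => ω y ![a, c]) x b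
        + fderiv ℝ (fun y => ω y ![a, b]) x c := by
    intro a b c
    have f0 : (fun j : Fin 2 => (![a, b, c] : Fin 3 → Fin n → ℝ) ((0 : Fin 3).succAbove j))
        = ![b, c] := by ext i; fin_cases i <;> rfl
    have f1 : (fun j : Fin 2 => (![a, b, c] : Fin 3 → Fin n → ℝ) ((1 : Fin 3).succAbove j))
        = ![a, c] := by ext i; fin_cases i <;> rfl
    have f2 : (fun j : Fin 2 => (![a, b, c] : Fin 3 → Fin n → ℝ) ((2 : Fin 3).succAbove j))
        = ![a, b] := by ext i; fin_cases i <;> rfl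
    refine (Fin.sum_univ_three _).trans ?_
    change (-1 : ℝ) ^ 0 * fderiv ℝ (fun y => ω y (fun j : Fin 2 =>
        (![a, b, c] : Fin 3 → Fin n → ℝ) ((0 : Fin 3).succAbove j))) x a
      + (-1 : ℝ) ^ 1 * fderiv ℝ (fun y => ω y (fun j : Fin 2 =>
        (![a, b, c] : Fin 3 → Fin n → ℝ) ((1 : Fin 3).succAbove j))) x b
      + (-1 : ℝ) ^ 2 * fderiv ℝ (fun y => ω y (fun j : Fin 2 =>
        (![a, b, c] : Fin 3 → Fin n → ℝ) ((2 : Fin 3).succAbove j))) x c = _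
    simp only [f0, f1, f2]
    ring
  have h1 := hXsymp x hx ![E x, v 0]
  rw [hd X dX] at h1
  have h2 := hLie x hx ![X x, v 0]
  have h2' : interiorProd E (extD fun y w => ω y w) x ![X x, v 0] = 0 := hclosed x hx _
  rw [lieDeriv, h2', hd E dE] at h2
  have h3 := hclosed x hx ![E x, X x, v 0]
  rw [hcl] at h3
  have h4 : ω x ![fderiv ℝ X x (E x), v 0] - ω x ![fderiv ℝ E x (X x), v 0]
      = l * ω x ![X x, v 0] := by
    have hb := hbracket x hx
    have e : fderiv ℝ X x (E x) = fderiv ℝ E x (X x) + l • X x := by rw [← hb]; abel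
    rw [e, two_form_expand _ (_ + _), two_form_expand _ (fderiv ℝ E x (X x)),
      two_form_expand _ (X x), Finset.mul_sum, ← Finset.sum_sub_distrib]
    refine Finset.sum_congr rfl fun i _ => ?_
    rw [Finset.mul_sum, ← Finset.sum_sub_distrib]
    refine Finset.sum_congr rfl fun j _ => ?_
    simp
    ring
  have h5 := two_form_fderiv ω x dω X E dX dE (v 0)
  have h6 := two_form_swap (ω x) (fderiv ℝ E x (v 0)) (X x)
  have hl : interiorProd X (fun y w => ω y w) x v = ω x ![X x, v 0] := by
    have : (Fin.cons (X x) v : Fin 2 → Fin n → ℝ) = ![X x, v 0] := by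
      ext i; fin_cases i <;> rfl
    simp only [interiorProd, this]
  have dH : DifferentiableAt ℝ (fun y => ω y ![X y, E y]) x := by
    have dXi := differentiableAt_pi.1 dX
    have dEi := differentiableAt_pi.1 dE
    simp only [two_form_expand (ω _) (X _) (E _)]
    exact DifferentiableAt.fun_sum fun i _ => DifferentiableAt.fun_sum fun j _ =>
      ((dXi i).fun_mul (dEi j)).fun_mul (dω _)
  have hr : extD (fun y (_ : Fin 0 → (Fin n → ℝ)) => (1 / (k + l)) * ω y ![X y, E y]) x v
      = (1 / (k + l)) * fderiv ℝ (fun y => ω y ![X y, E y]) x (v 0) := by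
    simp only [extD]
    rw [fderiv_const_mul dH]
    simp
  rw [hl, hr, h5, one_div, eq_inv_mul_iff_mul_eq₀ hkl]
  linarith
end

section
/- Let U be an open subset of ℝⁿ and let σ be a smooth closed 2-form on U. Let V and Z be smooth vector fields on U and g a smooth function on U such that ι_V σ = 0 and ι_Z σ = dg. Then ι_{[V,Z]} σ = 0. -/
open scoped BigOperators

/-- Product rule for a 2-form contracted with a vector field. -/
lemma fderiv_form_apply {n : ℕ} (σ : (Fin n → ℝ) → ((Fin n → ℝ) [⋀^Fin 2]→ₗ[ℝ] ℝ))
    (A : (Fin n → ℝ) → (Fin n → ℝ)) (x w u : Fin n → ℝ)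
    (hσ : ∀ v : Fin 2 → (Fin n → ℝ), DifferentiableAt ℝ (fun y => σ y v) x)
    (hA : DifferentiableAt ℝ A x) :
    fderiv ℝ (fun y => σ y ![A y, w]) x u =
      fderiv ℝ (fun y => σ y ![A x, w]) x u + σ x ![fderiv ℝ A x u, w] := by
  have key : ∀ (y a : Fin n → ℝ), σ y ![a, w] =
      ∑ i, a i * σ y ![Pi.single i (1 : ℝ), w] := by
    intro y a
    have upd : ∀ a : Fin n → ℝ, Function.update ![0, w] 0 a = ![a, w] := by
      intro a; ext i j; fin_cases i <;> rfl
    let L : (Fin n → ℝ) →ₗ[ℝ] ℝ :=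
      { toFun := fun a => σ y ![a, w]
        map_add' := fun a b => by
          have := (σ y).map_update_add ![0, w] 0 a b
          simpa only [upd] using this
        map_smul' := fun c a => by
          have := (σ y).map_update_smul ![0, w] 0 c a
          simpa only [upd, RingHom.id_apply] using this }
    have h := LinearMap.pi_apply_eq_sum_univ L a
    have e : ∀ i : Fin n, (fun j => if i = j then (1 : ℝ) else 0) = Pi.single i 1 := by
      intro i; ext j; simp [Pi.single_apply, eq_comm]
    simp only [e, smul_eq_mul] at h
    exact h
  have hAi : ∀ i, HasFDerivAt (fun y => A y i)
      ((ContinuousLinearMap.proj (R := ℝ) (φ := fun _ : Fin n => ℝ) i).comp (fderiv ℝ A x)) x :=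
    fun i => (hasFDerivAt_pi'.1 hA.hasFDerivAt i)
  have h1 := HasFDerivAt.fun_sum (u := Finset.univ) fun i _ =>
      (hAi i).mul (hσ ![Pi.single i (1 : ℝ), w]).hasFDerivAt
  have h2 := HasFDerivAt.fun_sum (u := Finset.univ) fun i _ =>
      (hσ ![Pi.single i (1 : ℝ), w]).hasFDerivAt.const_mul (A x i)
  rw [funext fun y => key y (A y), funext fun y => key y (A x)]
  simp only [Pi.mul_apply] at h1
  rw [h1.fderiv, h2.fderiv, key x (fderiv ℝ A x u)]
  simp [ContinuousLinearMap.sum_apply, Finset.sum_add_distrib, mul_comm]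

/-- If `V` lies in the kernel of a smooth closed 2-form `σ` on an open `U ⊆ ℝⁿ` and `Z`
is a vector field with `ι_Z σ = dg` for a smooth function `g`, then the bracket `[V,Z]`
lies in the kernel of `σ` as well. -/
theorem bracket_with_hamiltonian_in_kernel
    {n : ℕ} {U : Set (Fin n → ℝ)} (hU : IsOpen U)
    (σ : (Fin n → ℝ) → ((Fin n → ℝ) [⋀^Fin 2]→ₗ[ℝ] ℝ))
    (V Z : (Fin n → ℝ) → (Fin n → ℝ)) (g : (Fin n → ℝ) → ℝ)
    (hσ : ∀ v : Fin 2 → (Fin n → ℝ), ContDiffOn ℝ (⊤ : ℕ∞) (fun x => σ x v) U)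
    (hV : ContDiffOn ℝ (⊤ : ℕ∞) V U) (hZ : ContDiffOn ℝ (⊤ : ℕ∞) Z U)
    (hg : ContDiffOn ℝ (⊤ : ℕ∞) g U)
    (hclosed : ∀ x ∈ U, ∀ v : Fin 3 → (Fin n → ℝ),
      extD (fun y w => σ y w) x v = 0)
    (hVker : ∀ x ∈ U, ∀ v : Fin 1 → (Fin n → ℝ),
      interiorProd V (fun y w => σ y w) x v = 0)
    (hZham : ∀ x ∈ U, ∀ v : Fin 1 → (Fin n → ℝ),
      interiorProd Z (fun y w => σ y w) x v =
        extD (fun y (_ : Fin 0 → (Fin n → ℝ)) => g y) x v) :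
    ∀ x ∈ U, ∀ v : Fin 1 → (Fin n → ℝ),
      interiorProd (fun y => fderiv ℝ Z y (V y) - fderiv ℝ V y (Z y))
        (fun y w => σ y w) x v = 0 := by
  intro x hx v
  have hUx : U ∈ nhds x := hU.mem_nhds hx
  have dσ : ∀ v : Fin 2 → (Fin n → ℝ), DifferentiableAt ℝ (fun y => σ y v) x :=
    fun v => ((hσ v).contDiffAt hUx).differentiableAt (by simp)
  have dV : DifferentiableAt ℝ V x := (hV.contDiffAt hUx).differentiableAt (by simp)
  have dZ : DifferentiableAt ℝ Z x := (hZ.contDiffAt hUx).differentiableAt (by simp)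
  have hgx : ContDiffAt ℝ (⊤ : ℕ∞) g x := hg.contDiffAt hUx
  have dg : DifferentiableAt ℝ (fderiv ℝ g) x :=
    (hgx.fderiv_right (m := 1) (by norm_cast)).differentiableAt (by simp)
  have hsymm : IsSymmSndFDerivAt ℝ g x := hgx.isSymmSndFDerivAt (by
    simp only [minSmoothness_of_isRCLikeNormedField]; norm_cast)
  have cons2 : ∀ (a : Fin n → ℝ) (v : Fin 1 → (Fin n → ℝ)),
      (Fin.cons a v : Fin 2 → (Fin n → ℝ)) = ![a, v 0] := by
    intro a v; ext i j; fin_cases i <;> rfl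
  have kV : ∀ y ∈ U, ∀ w, σ y ![V y, w] = 0 := by
    intro y hy w
    have := hVker y hy ![w]
    simp only [interiorProd, cons2] at this
    exact this
  have kZ : ∀ y ∈ U, ∀ w, σ y ![Z y, w] = fderiv ℝ g y w := by
    intro y hy w
    have := hZham y hy ![w]
    simp only [interiorProd, cons2] at this
    simpa [extD] using this
  have swap : ∀ y a b, σ y ![a, b] = - σ y ![b, a] := by
    intro y a b
    have h := (σ y).map_swap ![b, a] (i := 0) (j := 1) (by simp)
    rw [← h]
    congr 1
    ext i j; fin_cases i <;> rfl
  have sub0 : ∀ a b w, σ x ![a - b, w] = σ x ![a, w] - σ x ![b, w] := by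
    intro a b w
    have upd : ∀ a : Fin n → ℝ, Function.update ![0, w] 0 a = ![a, w] := by
      intro a; ext i j; fin_cases i <;> rfl
    have := (σ x).map_update_sub ![0, w] 0 a b
    simpa only [upd] using this
  have eZ : ∀ w u, fderiv ℝ (fun y => σ y ![Z y, w]) x u = fderiv ℝ (fderiv ℝ g) x u w := by
    intro w u
    have : (fun y => σ y ![Z y, w]) =ᶠ[nhds x] fun y => fderiv ℝ g y w := by
      filter_upwards [hUx] with y hy using kZ y hy w
    rw [this.fderiv_eq, fderiv_clm_apply dg (differentiableAt_const w)]
    simp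
  have eV : ∀ w u, fderiv ℝ (fun y => σ y ![V y, w]) x u = 0 := by
    intro w u
    have : (fun y => σ y ![V y, w]) =ᶠ[nhds x] fun y => (0 : ℝ) := by
      filter_upwards [hUx] with y hy using kV y hy w
    rw [this.fderiv_eq]
    simp
  have hc := hclosed x hx ![V x, Z x, v 0]
  have r0 : (fun j => (![V x, Z x, v 0] : Fin 3 → (Fin n → ℝ)) ((0 : Fin 3).succAbove j))
      = ![Z x, v 0] := by ext i j; fin_cases i <;> rfl
  have r1 : (fun j => (![V x, Z x, v 0] : Fin 3 → (Fin n → ℝ)) ((1 : Fin 3).succAbove j))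
      = ![V x, v 0] := by ext i j; fin_cases i <;> rfl
  have r2 : (fun j => (![V x, Z x, v 0] : Fin 3 → (Fin n → ℝ)) ((2 : Fin 3).succAbove j))
      = ![V x, Z x] := by ext i j; fin_cases i <;> rfl
  simp only [extD] at hc
  rw [Fin.sum_univ_three, r0, r1, r2] at hc
  have hsw : fderiv ℝ (fun y => σ y ![V x, Z x]) x (v 0) =
      - fderiv ℝ (fun y => σ y ![Z x, V x]) x (v 0) := by
    simp_rw [fun y => swap y (V x) (Z x)]
    rw [fderiv_fun_neg]; rfl
  have p1 := fderiv_form_apply σ Z x (v 0) (V x) dσ dZ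
  have p2 := fderiv_form_apply σ V x (v 0) (Z x) dσ dV
  have p3 := fderiv_form_apply σ Z x (V x) (v 0) dσ dZ
  rw [eZ] at p1 p3
  rw [eV] at p2
  have z := kV x hx (fderiv ℝ Z x (v 0))
  rw [swap] at z
  have hs := hsymm.eq (V x) (v 0)
  simp only [interiorProd, cons2]
  rw [sub0]
  simp at hc
  linarith
end

section
/- Let V be a real vector space and b : V × V → V an alternating bilinear map. For each n ≥ 0 define the map δ sending an alternating n-linear form α : Vⁿ → ℝ to the alternating (n+1)-linear form (δα)(v₀, …, v_n) = Σ_{0 ≤ i < j ≤ n} (−1)^{i+j} α(b(v_i, v_j), v₀, …, v̂_i, …, v̂_j, …, v_n) (hats denoting omitted arguments). Then δ∘δ = 0 on alternating forms of every degree if and only if b satisfies the Jacobi identity b(b(u,v), w) + b(b(v,w), u) + b(b(w,u), v) = 0 for all u, v, w ∈ V. -/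
open scoped BigOperators

/-- The Chevalley–Eilenberg differential associated to an alternating bilinear map
`b : V × V → V`:
`(δα)(v₀, …, v_{m+1}) = ∑_{i<j} (−1)^{i+j} α(b(v_i, v_j), v₀, …, v̂_i, …, v̂_j, …)`. -/
def ceDiff {V : Type*} [AddCommGroup V] [Module ℝ V]
    (b : V →ₗ[ℝ] V →ₗ[ℝ] V) {m : ℕ}
    (α : (Fin (m + 1) → V) → ℝ) : (Fin (m + 2) → V) → ℝ :=
  fun v => ∑ j : Fin (m + 2), ∑ i : Fin (m + 2),
    if h : (i : ℕ) < (j : ℕ) then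
      (-1 : ℝ) ^ ((i : ℕ) + (j : ℕ)) *
        α (Fin.cons (b (v i) (v j)) (fun s : Fin m =>
          v (j.succAbove
            ((⟨(i : ℕ), lt_of_lt_of_le h (Nat.lt_succ_iff.mp j.isLt)⟩ :
              Fin (m + 1)).succAbove s))))
    else 0


namespace CEProof

set_option linter.unusedSectionVars false

variable {V : Type*} [AddCommGroup V] [Module ℝ V]

/-- Contraction with `x` in the first slot. -/
def ctr {n : ℕ} (x : V) (α : (Fin (n + 1) → V) → ℝ) : (Fin n → V) → ℝ :=
  fun v => α (Fin.cons x v)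

theorem ctr_ext {n : ℕ} {α β : (Fin (n + 1) → V) → ℝ} (h : ∀ x, ctr x α = ctr x β) : α = β := by
  funext v
  have := congrFun (h (v 0)) (Fin.tail v)
  simpa [ctr] using this

theorem ctr_add {n : ℕ} (x : V) (α β : (Fin (n + 1) → V) → ℝ) :
    ctr x (α + β) = ctr x α + ctr x β := rfl
theorem ctr_sub {n : ℕ} (x : V) (α β : (Fin (n + 1) → V) → ℝ) :
    ctr x (α - β) = ctr x α - ctr x β := rfl
theorem ctr_neg {n : ℕ} (x : V) (α : (Fin (n + 1) → V) → ℝ) :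
    ctr x (-α) = - ctr x α := rfl
theorem ctr_zero {n : ℕ} (x : V) : ctr x (0 : (Fin (n + 1) → V) → ℝ) = 0 := rfl

/-- Lie derivative, defined recursively. -/
def Li (b : V →ₗ[ℝ] V →ₗ[ℝ] V) (x : V) : ∀ {n : ℕ}, ((Fin n → V) → ℝ) → ((Fin n → V) → ℝ)
  | 0, _ => 0
  | _ + 1, α => fun v => Li b x (ctr (v 0) α) (Fin.tail v) - ctr (b x (v 0)) α (Fin.tail v)

/-- Differential, defined recursively by Cartan's formula. -/
def D (b : V →ₗ[ℝ] V →ₗ[ℝ] V) : ∀ {n : ℕ}, ((Fin n → V) → ℝ) → ((Fin (n + 1) → V) → ℝ)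
  | 0, _ => 0
  | _ + 1, α => fun v => Li b (v 0) α (Fin.tail v) - D b (ctr (v 0) α) (Fin.tail v)

variable (b : V →ₗ[ℝ] V →ₗ[ℝ] V)

theorem ctr_Li {n : ℕ} (x y : V) (α : (Fin (n + 1) → V) → ℝ) :
    ctr y (Li b x α) = Li b x (ctr y α) - ctr (b x y) α := by
  funext v
  simp [ctr, Li]

theorem ctr_D {n : ℕ} (y : V) (α : (Fin (n + 1) → V) → ℝ) :
    ctr y (D b α) = Li b y α - D b (ctr y α) := by
  funext v
  simp [ctr, D]

theorem Li_sub (x : V) {n : ℕ} (α β : (Fin n → V) → ℝ) :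
    Li b x (α - β) = Li b x α - Li b x β := by
  induction n with
  | zero => simp [Li]
  | succ n ih =>
    apply ctr_ext
    intro y
    simp only [ctr_Li, ctr_sub, ih]
    abel

theorem Li_zero (x : V) {n : ℕ} : Li b x (0 : (Fin n → V) → ℝ) = 0 := by
  simpa using Li_sub b x (0 : (Fin n → V) → ℝ) 0

theorem Li_neg (x : V) {n : ℕ} (α : (Fin n → V) → ℝ) : Li b x (-α) = - Li b x α := by
  simpa [Li_zero] using Li_sub b x 0 α

theorem D_sub {n : ℕ} (α β : (Fin n → V) → ℝ) : D b (α - β) = D b α - D b β := by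
  induction n with
  | zero => simp [D]
  | succ n ih =>
    apply ctr_ext
    intro y
    simp only [ctr_D, ctr_sub, ih, Li_sub]
    abel

theorem D_zero {n : ℕ} : D b (0 : (Fin n → V) → ℝ) = 0 := by
  simpa using D_sub b (0 : (Fin n → V) → ℝ) 0

theorem D_neg {n : ℕ} (α : (Fin n → V) → ℝ) : D b (-α) = - D b α := by
  simpa [D_zero] using D_sub b 0 α

/-- Additivity in each slot. -/
def Ad : ∀ {n : ℕ}, ((Fin n → V) → ℝ) → Prop
  | 0, _ => True
  | _ + 1, α => (∀ x, Ad (ctr x α)) ∧ ∀ x y, ctr (x + y) α = ctr x α + ctr y α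

/-- Antisymmetry in adjacent slots. -/
def An : ∀ {n : ℕ}, ((Fin n → V) → ℝ) → Prop
  | 0, _ => True
  | 1, _ => True
  | _ + 2, α => (∀ x, An (ctr x α)) ∧ ∀ x y, ctr y (ctr x α) = - ctr x (ctr y α)

theorem An.ctr {n : ℕ} {α : (Fin (n + 1) → V) → ℝ} (h : An α) (x : V) : An (ctr x α) := by
  cases n with
  | zero => trivial
  | succ n => exact h.1 x

theorem An.sub {n : ℕ} {α β : (Fin n → V) → ℝ} (h : An α) (h' : An β) : An (α - β) := by
  induction n with
  | zero => trivial
  | succ n ih =>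
    cases n with
    | zero => trivial
    | succ n =>
      refine ⟨fun x => ?_, fun x y => ?_⟩
      · rw [ctr_sub]; exact ih (h.1 x) (h'.1 x)
      · simp only [ctr_sub]
        rw [h.2 x y, h'.2 x y]; abel

theorem Ad.neg {n : ℕ} {α : (Fin (n + 1) → V) → ℝ} (h : Ad α) (x : V) :
    CEProof.ctr (-x) α = - CEProof.ctr x α := by
  have h0 := h.2 0 0
  have h1 := h.2 x (-x)
  simp only [add_zero, add_neg_cancel] at h0 h1
  have h2 : CEProof.ctr (0 : V) α = 0 := by simpa using h0
  rw [h2] at h1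
  exact (neg_eq_of_add_eq_zero_right h1.symm).symm

theorem An.Li {n : ℕ} {α : (Fin n → V) → ℝ} (h : An α) (x : V) : An (Li b x α) := by
  induction n with
  | zero => trivial
  | succ n ih =>
    cases n with
    | zero => trivial
    | succ n =>
      refine ⟨fun y => ?_, fun y z => ?_⟩
      · rw [ctr_Li]; exact (ih (h.1 y)).sub (h.1 _)
      · simp only [ctr_Li, ctr_sub]
        rw [h.2 y z, h.2 y (b x z), h.2 (b x y) z, Li_neg]; abel

theorem An.D (hb : ∀ v : V, b v v = 0) {n : ℕ} {α : (Fin n → V) → ℝ} (h : An α) (h' : Ad α) :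
    An (D b α) := by
  induction n with
  | zero => trivial
  | succ n ih =>
    refine ⟨fun y => ?_, fun y z => ?_⟩
    · rw [ctr_D]; exact (h.Li b y).sub (ih (h.ctr y) (h'.1 y))
    · have hs : b z y = - b y z := by
        have := hb (y + z)
        simp only [map_add, LinearMap.add_apply, hb, zero_add, add_zero] at this
        exact eq_neg_of_add_eq_zero_left (by simpa [add_comm] using this)
      cases n with
      | zero =>
        simp only [ctr_D, ctr_Li, ctr_sub]
        rw [hs, h'.neg]
        simp [CEProof.Li, CEProof.D, ctr_zero]
      | succ n =>
        simp only [ctr_D, ctr_Li, ctr_sub]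
        rw [hs, h'.neg, h.2 y z, D_neg]
        abel

theorem Li_comm (hJ : ∀ x y z, b x (b y z) = b y (b x z) + b (b x y) z) (x y : V)
    {n : ℕ} {α : (Fin n → V) → ℝ} (h : Ad α) :
    Li b x (Li b y α) = Li b y (Li b x α) + Li b (b x y) α := by
  induction n with
  | zero => simp [Li]
  | succ n ih =>
    apply ctr_ext
    intro z
    simp only [ctr_Li, ctr_add, Li_sub]
    rw [ih (h.1 z), hJ x y z, h.2]
    abel

theorem Li_D (hJ : ∀ x y z, b x (b y z) = b y (b x z) + b (b x y) z) (x : V)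
    {n : ℕ} {α : (Fin n → V) → ℝ} (h : Ad α) :
    Li b x (D b α) = D b (Li b x α) := by
  induction n with
  | zero => simp [D, Li_zero]
  | succ n ih =>
    apply ctr_ext
    intro y
    simp only [ctr_Li, ctr_D, Li_sub, D_sub]
    rw [ih (h.1 y), Li_comm b hJ x y h]
    abel

theorem D_D (hJ : ∀ x y z, b x (b y z) = b y (b x z) + b (b x y) z)
    {n : ℕ} {α : (Fin n → V) → ℝ} (h : Ad α) : D b (D b α) = 0 := by
  induction n with
  | zero =>
    have h0 : D b α = 0 := rfl
    rw [h0, D_zero]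
  | succ n ih =>
    apply ctr_ext
    intro y
    simp only [ctr_D, D_sub, ctr_zero]
    rw [ih (h.1 y), Li_D b hJ y h]
    abel

theorem Li_eq (x : V) {n : ℕ} {α : (Fin (n + 1) → V) → ℝ} (h : An α) (v : Fin (n + 1) → V) :
    Li b x α v = - ∑ j : Fin (n + 1), (-1 : ℝ) ^ (j : ℕ) *
      α (Fin.cons (b x (v j)) (fun s => v (j.succAbove s))) := by
  induction n with
  | zero =>
    simp only [Li, ctr, Fin.sum_univ_succ]
    simp
    rfl
  | succ n ih =>
    rw [Fin.sum_univ_succ]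
    change Li b x (ctr (v 0) α) (Fin.tail v) - ctr (b x (v 0)) α (Fin.tail v) = _
    rw [ih (h.1 _)]
    have key : ∀ j : Fin (n + 1), α (Fin.cons (b x (v j.succ)) (fun s => v (j.succ.succAbove s)))
        = - ctr (v 0) α (Fin.cons (b x (Fin.tail v j)) (fun s => Fin.tail v (j.succAbove s))) := by
      intro j
      have e : (fun s => v (j.succ.succAbove s))
          = Fin.cons (v 0) (fun s => Fin.tail v (j.succAbove s)) := by
        funext s
        refine Fin.cases ?_ (fun s => ?_) s
        · simp
        · simp [Fin.tail]
      rw [e]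
      exact congrFun (h.2 (b x (v j.succ)) (v 0)) _
    simp only [key]
    simp only [Fin.val_succ, pow_succ, Fin.val_zero, pow_zero, one_mul, Fin.zero_succAbove]
    simp only [mul_neg, mul_one, neg_mul, neg_neg, neg_add, sub_eq_add_neg]
    rw [add_comm]
    rfl

theorem ceDiff_cons {m : ℕ} (α : (Fin (m + 1 + 1) → V) → ℝ) (h : An α)
    (x : V) (v : Fin (m + 2) → V) :
    ceDiff b α (Fin.cons x v) = Li b x α v - ceDiff b (ctr x α) v := by
  rw [Li_eq b x h]
  unfold ceDiff
  rw [Fin.sum_univ_succ]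
  have h0 : ∀ i : Fin (m + 1 + 2), ¬ ((i : ℕ) < ((0 : Fin (m + 1 + 2)) : ℕ)) := by simp
  simp only [h0, dite_false, Finset.sum_const_zero, zero_add]
  rw [← Finset.sum_neg_distrib, ← Finset.sum_sub_distrib]
  refine Finset.sum_congr rfl fun j _ => ?_
  rw [Fin.sum_univ_succ, sub_eq_add_neg, ← Finset.sum_neg_distrib]
  congr 1
  · simp [pow_succ]
  · refine Finset.sum_congr rfl fun i _ => ?_
    by_cases hij : (i : ℕ) < (j : ℕ)
    · have hij' : (i.succ : ℕ) < (j.succ : ℕ) := by simpa using hij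
      rw [dif_pos hij, dif_pos hij']
      have e : (fun s : Fin (m + 1) => (Fin.cons x v : Fin (m + 3) → V) (j.succ.succAbove
          ((⟨(i.succ : ℕ), lt_of_lt_of_le hij' (Nat.lt_succ_iff.mp j.succ.isLt)⟩ :
            Fin (m + 2)).succAbove s)))
          = Fin.cons x (fun s : Fin m => v (j.succAbove
            ((⟨(i : ℕ), lt_of_lt_of_le hij (Nat.lt_succ_iff.mp j.isLt)⟩ :
              Fin (m + 1)).succAbove s))) := by
        have e2 : (⟨(i.succ : ℕ), lt_of_lt_of_le hij' (Nat.lt_succ_iff.mp j.succ.isLt)⟩ :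
            Fin (m + 2)) = Fin.succ ⟨(i : ℕ), lt_of_lt_of_le hij (Nat.lt_succ_iff.mp j.isLt)⟩ := by
          ext; simp
        rw [e2]
        generalize (⟨(i : ℕ), lt_of_lt_of_le hij (Nat.lt_succ_iff.mp j.isLt)⟩ : Fin (m + 1)) = k
        funext s
        refine Fin.cases ?_ (fun s => ?_) s
        · rw [Fin.succ_succAbove_zero, Fin.succ_succAbove_zero, Fin.cons_zero, Fin.cons_zero]
        · rw [Fin.succ_succAbove_succ, Fin.succ_succAbove_succ, Fin.cons_succ, Fin.cons_succ]
      rw [e]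
      have := congrFun (h.2 (b (v i) (v j)) x) (fun s : Fin m => v (j.succAbove
            ((⟨(i : ℕ), lt_of_lt_of_le hij (Nat.lt_succ_iff.mp j.isLt)⟩ :
              Fin (m + 1)).succAbove s)))
      simp only [ctr, Pi.neg_apply] at this
      simp only [Fin.cons_succ, ctr, Fin.val_succ]
      rw [this]
      ring
    · have hij' : ¬ (i.succ : ℕ) < (j.succ : ℕ) := by simpa using hij
      rw [dif_neg hij, dif_neg hij']
      simp

theorem ceDiff_eq {m : ℕ} (α : (Fin (m + 1) → V) → ℝ) (h : An α) : ceDiff b α = D b α := by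
  induction m with
  | zero =>
    funext v
    unfold ceDiff
    rw [Fin.sum_univ_two, Fin.sum_univ_two, Fin.sum_univ_two, dif_neg (by simp), dif_neg (by simp),
      dif_pos (by simp), dif_neg (by simp)]
    change _ = (0 : ℝ) - α (Fin.cons (b (v 0) (v 1)) _) - 0
    have e : ∀ f g : Fin 0 → V, α (Fin.cons (b (v 0) (v 1)) f) = α (Fin.cons (b (v 0) (v 1)) g) := by
      intro f g
      rw [Subsingleton.elim f g]
    rw [e _ (fun i => i.elim0)]
    have e' := e (Fin.tail (Fin.tail v)) (fun i => i.elim0)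
    refine Eq.trans ?_ (congrArg (fun t : ℝ => 0 - t - 0) e'.symm)
    simp
  | succ m ih =>
    apply ctr_ext
    intro x
    rw [ctr_D, ← ih _ (h.ctr x)]
    funext v
    exact ceDiff_cons b α h x v

theorem alt_Ad {n : ℕ} (α : V [⋀^Fin n]→ₗ[ℝ] ℝ) : Ad (fun w => α w) := by
  induction n with
  | zero => trivial
  | succ n ih =>
    refine ⟨fun x => ih (α.curryLeft x), fun x y => ?_⟩
    funext v
    change (α.curryLeft (x + y)) v = α.curryLeft x v + α.curryLeft y v
    simp only [map_add, AlternatingMap.add_apply]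

theorem alt_An {n : ℕ} (α : V [⋀^Fin n]→ₗ[ℝ] ℝ) : An (fun w => α w) := by
  induction n with
  | zero => trivial
  | succ n ih =>
    cases n with
    | zero => trivial
    | succ n =>
      refine ⟨fun x => ih (α.curryLeft x), fun x y => ?_⟩
      funext v
      have h : ∀ z, (α.curryLeft z).curryLeft z = 0 := fun z => α.curryLeft_same z
      have h1 := DFunLike.congr_fun (h (x + y)) v
      have hx := DFunLike.congr_fun (h x) v
      have hy := DFunLike.congr_fun (h y) v
      simp only [map_add, AlternatingMap.curryLeft_add, LinearMap.add_apply,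
        AlternatingMap.add_apply, AlternatingMap.zero_apply] at h1 hx hy
      change ((α.curryLeft x).curryLeft y) v = - ((α.curryLeft y).curryLeft x) v
      linarith

end CEProof

/-- `δ ∘ δ = 0` on alternating forms of every degree if and only if the alternating
bilinear map `b` satisfies the Jacobi identity. -/
theorem ce_differential_squares_to_zero_iff_jacobi
    {V : Type*} [AddCommGroup V] [Module ℝ V]
    (b : V →ₗ[ℝ] V →ₗ[ℝ] V) (hb : ∀ v : V, b v v = 0) :
    (∀ (m : ℕ) (α : V [⋀^Fin (m + 1)]→ₗ[ℝ] ℝ) (v : Fin (m + 3) → V),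
        ceDiff b (ceDiff b (fun w => α w)) v = 0) ↔
      ∀ u v w : V, b (b u v) w + b (b v w) u + b (b w u) v = 0 := by
  have hs : ∀ y z, b z y = - b y z := by
    intro y z
    have := hb (y + z)
    simp only [map_add, LinearMap.add_apply, hb, zero_add, add_zero] at this
    exact eq_neg_of_add_eq_zero_left (by simpa [add_comm] using this)
  constructor
  · intro H u v w
    rw [← Module.forall_dual_apply_eq_zero_iff ℝ]
    intro f
    have h := H 0 (AlternatingMap.ofSubsingleton ℝ V ℝ (0 : Fin 1) f) ![u, v, w]
    rw [CEProof.ceDiff_eq b _ (CEProof.alt_An _),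
      CEProof.ceDiff_eq b _ ((CEProof.alt_An _).D b hb (CEProof.alt_Ad _))] at h
    have e : ∀ x y z : V, b (b z x) y = - b (b x z) y := by
      intro x y z
      rw [hs x z]; simp
    simp [CEProof.D, CEProof.Li, CEProof.ctr, Fin.tail] at h
    rw [e u v w]
    rw [hs (b u w) v, hs (b v w) u] at h
    simp only [map_add, map_neg] at h ⊢
    linarith
  · intro J m α v
    have hJ : ∀ x y z, b x (b y z) = b y (b x z) + b (b x y) z := by
      intro x y z
      have h := J x y z
      rw [hs (b y z) x, hs (b x z) y]
      rw [hs x z] at h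
      simp only [map_neg, LinearMap.neg_apply] at *
      rw [← sub_eq_zero, ← neg_eq_zero, ← h]
      abel
    rw [CEProof.ceDiff_eq b _ (CEProof.alt_An α),
      CEProof.ceDiff_eq b _ ((CEProof.alt_An α).D b hb (CEProof.alt_Ad α)),
      CEProof.D_D b hJ (CEProof.alt_Ad α)]
    rfl
end
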